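/- arXiv:1412.5308 — 3 statements merged into one kernel-verified Lean document; each statement's English description precedes it below -/
import Mathlib

section
/- Given an enriched graph (Γ, p), if e_1, e_2 and e_3 are edges in Γ such that e_1 ≼_p e_3 and e_2 ≼_p e_3, then either e_1 ≼_p e_2 or e_2 ≼_p e_1. -/
/-- A finite multigraph: finitely many vertices and edges, each edge has two
(ordered, possibly equal) endpoints; loops and multiple edges are allowed. -/
structure Multigraph where
  V : Type
  E : Type
  [finV : Finite V]
  [finE : Finite E]
  fst : E → V
  snd : E → V

attribute [instance] Multigraph.finV Multigraph.finE

namespace Multigraph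

variable (Γ : Multigraph)

/-- `v` is an endpoint of the edge `e`. -/
def Inc (v : Γ.V) (e : Γ.E) : Prop := Γ.fst e = v ∨ Γ.snd e = v

/-- `e` is a loop. -/
def IsLoop (e : Γ.E) : Prop := Γ.fst e = Γ.snd e

/-- Adjacency inside the induced subgraph on the vertex set `W`. -/
def AdjOn (W : Set Γ.V) (a b : Γ.V) : Prop :=
  a ∈ W ∧ b ∈ W ∧ ∃ e : Γ.E, (Γ.fst e = a ∧ Γ.snd e = b) ∨ (Γ.fst e = b ∧ Γ.snd e = a)

/-- The induced subgraph on `W` is (nonempty and) connected. -/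
def ConnectedOn (W : Set Γ.V) : Prop :=
  W.Nonempty ∧ ∀ a ∈ W, ∀ b ∈ W, Relation.ReflTransGen (Γ.AdjOn W) a b

/-- `Γ` is connected. -/
def Connected : Prop := Γ.ConnectedOn Set.univ

/-- A separating vertex: its removal disconnects the graph; moreover a vertex
carrying a loop is separating provided at least one other edge is attached to it. -/
def SeparatingVertex (v : Γ.V) : Prop :=
  ({w : Γ.V | w ≠ v}.Nonempty ∧ ¬ Γ.ConnectedOn {w : Γ.V | w ≠ v}) ∨
  (∃ e₁ e₂ : Γ.E, e₁ ≠ e₂ ∧ Γ.IsLoop e₁ ∧ Γ.Inc v e₁ ∧ Γ.Inc v e₂)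

/-- `Γ` is biconnected: connected and without separating vertices. -/
def Biconnected : Prop := Γ.Connected ∧ ∀ v : Γ.V, ¬ Γ.SeparatingVertex v

/-- The set `E(W, Wᶜ)` of edges joining a vertex of `W` to a vertex outside `W` (a *cut*). -/
def crossEdges (W : Set Γ.V) : Set Γ.E :=
  {e | (Γ.fst e ∈ W ∧ Γ.snd e ∉ W) ∨ (Γ.snd e ∈ W ∧ Γ.fst e ∉ W)}

/-- `W` determines a bond: a nontrivial partition `W ∪ Wᶜ` with both induced subgraphs
connected. -/
def IsBondOn (W : Set Γ.V) : Prop :=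
  W.Nonempty ∧ Wᶜ.Nonempty ∧ Γ.ConnectedOn W ∧ Γ.ConnectedOn Wᶜ

/-- A bond: a minimal cut. -/
def IsBond (B : Set Γ.E) : Prop := ∃ W : Set Γ.V, Γ.IsBondOn W ∧ B = Γ.crossEdges W

/-- The subgraph consisting of the edges in `F` together with their endpoints. -/
def edgeSubgraph (F : Set Γ.E) : Multigraph where
  V := {v : Γ.V // ∃ e ∈ F, Γ.Inc v e}
  E := {e : Γ.E // e ∈ F}
  fst := fun e => ⟨Γ.fst e.1, e.1, e.2, Or.inl rfl⟩
  snd := fun e => ⟨Γ.snd e.1, e.1, e.2, Or.inr rfl⟩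

/-- A biconnected component: a maximal set of edges inducing a biconnected subgraph. -/
def IsBicomponent (F : Set Γ.E) : Prop :=
  (Γ.edgeSubgraph F).Biconnected ∧
    ∀ F' : Set Γ.E, F ⊆ F' → (Γ.edgeSubgraph F').Biconnected → F' = F

/-- The contraction `Γ/S` of `Γ`: all the edges in `S` are contracted; the remaining
edges are `E(Γ) \ S`. -/
def contract (S : Set Γ.E) : Multigraph where
  V := Quot (fun a b : Γ.V => ∃ e ∈ S, Γ.fst e = a ∧ Γ.snd e = b)
  E := {e : Γ.E // e ∉ S}
  fst := fun e => Quot.mk _ (Γ.fst e.1)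
  snd := fun e => Quot.mk _ (Γ.snd e.1)

/-- Enriched graphs (Abreu–Pacini): `p` is an enriched structure on `Γ`, i.e. a
preorder on the edges satisfying the recursive conditions (1), (2), (3). -/
inductive IsEnriched : ∀ G : Multigraph, (G.E → G.E → Prop) → Prop
  | of_subsingleton (G : Multigraph) (p : G.E → G.E → Prop)
      (hrefl : Reflexive p) (htrans : Transitive p) (hsub : Subsingleton G.E) :
      IsEnriched G p
  | of_biconnected (G : Multigraph) (p : G.E → G.E → Prop)
      (hrefl : Reflexive p) (htrans : Transitive p)
      (hbic : G.Biconnected) (S : Set G.E) (hne : S.Nonempty)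
      (hlow : ∀ e e' : G.E, p e e' → e' ∈ S → e ∈ S)
      (hmin : ∀ e ∈ S, ∀ e' : G.E, p e e')
      (hrec : IsEnriched (G.contract S) (fun a b => p a.1 b.1)) :
      IsEnriched G p
  | of_separating (G : Multigraph) (p : G.E → G.E → Prop)
      (hrefl : Reflexive p) (htrans : Transitive p)
      (hsep : ∃ v : G.V, G.SeparatingVertex v)
      (hcomp : ∀ F : Set G.E, G.IsBicomponent F →
        IsEnriched (G.edgeSubgraph F) (fun a b => p a.1 b.1))
      (hincomp : ∀ F F' : Set G.E, G.IsBicomponent F → G.IsBicomponent F' → F ≠ F' →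
        ∀ e ∈ F, ∀ e' ∈ F', ¬ p e e') :
      IsEnriched G p

/-- `a ∼ₚ b`. -/
def Esim (p : Γ.E → Γ.E → Prop) (a b : Γ.E) : Prop := p a b ∧ p b a

/-- `a <ₚ b`. -/
def StrictBelow (p : Γ.E → Γ.E → Prop) (a b : Γ.E) : Prop := p a b ∧ ¬ p b a

/-- The classes of `a` and `b` are consecutive (with `a` below `b`). -/
def Consecutive (p : Γ.E → Γ.E → Prop) (a b : Γ.E) : Prop :=
  StrictBelow Γ p a b ∧ ∀ c : Γ.E, ¬ (StrictBelow Γ p a c ∧ StrictBelow Γ p c b)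

/-- The specialization `(Γ, p) ⇝ (Γ, p')` (same underlying graph, `S = ∅`). -/
def SpecializesSame (p p' : Γ.E → Γ.E → Prop) : Prop :=
  IsEnriched Γ p ∧ IsEnriched Γ p' ∧ ∀ e e' : Γ.E, p e e' → p' e e'

/-- The specialization `(Γ, p) ⇝ (Γ/S, p')`. -/
def Specializes (p : Γ.E → Γ.E → Prop) (S : Set Γ.E)
    (p' : (Γ.contract S).E → (Γ.contract S).E → Prop) : Prop :=
  IsEnriched Γ p ∧ IsEnriched (Γ.contract S) p' ∧
  (∀ e e' : Γ.E, p e e' → e' ∈ S → e ∈ S) ∧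
  (∀ (e e' : Γ.E) (he : e ∉ S) (he' : e' ∉ S), p e e' → p' ⟨e, he⟩ ⟨e', he'⟩)

/-- A simple specialization `(Γ, p) ⇝ (Γ, p')`: it merges two consecutive classes. -/
def IsSimpleSpec (p p' : Γ.E → Γ.E → Prop) : Prop :=
  SpecializesSame Γ p p' ∧ ∃ e₁ e₂ : Γ.E, Consecutive Γ p e₁ e₂ ∧
    ∀ e e' : Γ.E, p' e e' ↔ p e e' ∨
      ((Esim Γ p e e₁ ∨ Esim Γ p e e₂) ∧ (Esim Γ p e' e₁ ∨ Esim Γ p e' e₂))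

/-- `rank(p)`: the number of equivalence classes of edges. -/
noncomputable def rank (p : Γ.E → Γ.E → Prop) : ℕ := Nat.card (Quot (Esim Γ p))

/-- The (relatively open) cone `K(Γ, p) ⊆ ℝ^{E(Γ)}`. -/
def K (p : Γ.E → Γ.E → Prop) : Set (Γ.E → ℝ) :=
  {x | (∀ e, 0 < x e) ∧ ∀ e e' : Γ.E, p e e' → x e ≤ x e' ∧ (x e = x e' ↔ p e' e)}

open Classical in
/-- The injective linear map `ī : ℝ^{E(Γ/S)} → ℝ^{E(Γ)}` (extension by zero). -/
noncomputable def extendZero (S : Set Γ.E) (y : (Γ.contract S).E → ℝ) : Γ.E → ℝ :=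
  fun e => if h : e ∈ S then 0 else y ⟨e, h⟩

end Multigraph

/-- A face of a closed convex cone `σ`: either `σ` itself, or `σ ∩ ker ℓ` for a linear
functional `ℓ` which is nonnegative on `σ`. -/
def IsFaceOf {α : Type} (σ F : Set (α → ℝ)) : Prop :=
  F = σ ∨ ∃ ℓ : (α → ℝ) →ₗ[ℝ] ℝ, (∀ x ∈ σ, 0 ≤ ℓ x) ∧ F = σ ∩ {x | ℓ x = 0}

namespace Multigraph

/-- A single edge, loop or not, spans a biconnected subgraph. -/
theorem biconnected_edgeSubgraph_singleton (Γ : Multigraph) (e : Γ.E) :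
    (Γ.edgeSubgraph {e}).Biconnected := by
  have hV : ∀ w : (Γ.edgeSubgraph {e}).V, Γ.fst e = w.1 ∨ Γ.snd e = w.1 := by
    rintro ⟨w, e', rfl, hw⟩
    exact hw
  have hpath : ∀ W : Set (Γ.edgeSubgraph {e}).V, ∀ a ∈ W, ∀ b ∈ W,
      Relation.ReflTransGen ((Γ.edgeSubgraph {e}).AdjOn W) a b := by
    intro W a ha b hb
    by_cases hab : a = b
    · rw [hab]
    · have hne : a.1 ≠ b.1 := fun h => hab (Subtype.ext h)
      refine .single ⟨ha, hb, ⟨e, rfl⟩, ?_⟩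
      rcases hV a with h | h <;> rcases hV b with h' | h'
      · exact absurd (h.symm.trans h') hne
      · exact Or.inl ⟨Subtype.ext h, Subtype.ext h'⟩
      · exact Or.inr ⟨Subtype.ext h', Subtype.ext h⟩
      · exact absurd (h.symm.trans h') hne
  refine ⟨⟨⟨⟨Γ.fst e, e, rfl, Or.inl rfl⟩, trivial⟩, hpath _⟩, ?_⟩
  rintro v (⟨hne, hnc⟩ | ⟨⟨a, ha⟩, ⟨b, hb⟩, hab, -⟩)
  · exact hnc ⟨hne, hpath _⟩
  · exact hab (Subtype.ext (Eq.trans ha (Eq.symm hb)))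

/-- Every edge lies in some biconnected component. -/
theorem exists_isBicomponent_mem (Γ : Multigraph) (e : Γ.E) :
    ∃ F : Set Γ.E, Γ.IsBicomponent F ∧ e ∈ F := by
  obtain ⟨F, hle, hF⟩ := Set.Finite.exists_le_maximal
    (Set.toFinite {F : Set Γ.E | (Γ.edgeSubgraph F).Biconnected})
    (Γ.biconnected_edgeSubgraph_singleton e)
  exact ⟨F, ⟨hF.prop, fun F' h h' => (hF.eq_of_le h' h).symm⟩, hle rfl⟩

end Multigraph

/-- Proposition 3.4: in an enriched graph, any two edges lying below a
common edge are comparable. -/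
theorem comparable_of_below (Γ : Multigraph) (p : Γ.E → Γ.E → Prop)
    (h : Multigraph.IsEnriched Γ p) (e₁ e₂ e₃ : Γ.E)
    (h₁ : p e₁ e₃) (h₂ : p e₂ e₃) :
    p e₁ e₂ ∨ p e₂ e₁ := by
  induction h with
  | of_subsingleton G p hrefl htrans hsub =>
    rw [Subsingleton.elim e₂ e₁]
    exact Or.inl (hrefl e₁)
  | of_biconnected G p hrefl htrans hbic S hne hlow hmin hrec ih =>
    by_cases he₁ : e₁ ∈ S
    · exact Or.inl (hmin e₁ he₁ e₂)
    by_cases he₂ : e₂ ∈ S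
    · exact Or.inr (hmin e₂ he₂ e₁)
    exact ih ⟨e₁, he₁⟩ ⟨e₂, he₂⟩ ⟨e₃, fun he₃ => he₁ (hlow e₁ e₃ h₁ he₃)⟩ h₁ h₂
  | of_separating G p hrefl htrans hsep hcomp hincomp ih =>
    obtain ⟨F, hF, he₃⟩ := G.exists_isBicomponent_mem e₃
    have hmem : ∀ e, p e e₃ → e ∈ F := by
      intro e he
      obtain ⟨F', hF', heF'⟩ := G.exists_isBicomponent_mem e
      by_cases hFF : F' = F
      · exact hFF ▸ heF'
      · exact absurd he (hincomp F' F hF' hF hFF e heF' e₃ he₃)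
    exact ih F hF ⟨e₁, hmem e₁ h₁⟩ ⟨e₂, hmem e₂ h₂⟩ ⟨e₃, he₃⟩ h₁ h₂
end

section
/- Given an enriched graph (Γ, p), for every edge e ∈ E(Γ) the set of classes {[e']_p : e' ≼_p e} is totally ordered by the induced partial order on E(Γ)_p. Consequently, the connected components of the Hasse diagram of the poset E(Γ)_p are rooted trees, whose roots are the classes of the elements of E(Γ) that are minimal with respect to p. -/
namespace Multigraph

namespace IsEnriched

variable {Γ : Multigraph} {p : Γ.E → Γ.E → Prop}

protected theorem refl (h : IsEnriched Γ p) : ∀ a, p a a := by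
  cases h <;> assumption

protected theorem trans (h : IsEnriched Γ p) : ∀ {a b c}, p a b → p b c → p a c := by
  cases h <;> assumption

end IsEnriched

/-- The edges below a given edge of an enriched graph are pairwise comparable. -/
theorem IsEnriched.total_of_le {Γ : Multigraph} {p : Γ.E → Γ.E → Prop} (h : IsEnriched Γ p) :
    ∀ e e₁ e₂ : Γ.E, p e₁ e → p e₂ e → p e₁ e₂ ∨ p e₂ e₁ := by
  induction h with
  | of_subsingleton G p hrefl _ hsub =>
    intro _ e₁ e₂ _ _
    exact .inl (hsub.elim e₁ e₂ ▸ hrefl e₁)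
  | of_biconnected G p _ _ _ S _ hlow hmin _ ih =>
    intro e e₁ e₂ h₁ h₂
    by_cases he₁ : e₁ ∈ S
    · exact .inl (hmin _ he₁ _)
    by_cases he₂ : e₂ ∈ S
    · exact .inr (hmin _ he₂ _)
    exact ih ⟨e, fun he => he₁ (hlow _ _ h₁ he)⟩ ⟨e₁, he₁⟩ ⟨e₂, he₂⟩ h₁ h₂
  | of_separating G p _ _ _ _ hincomp ih =>
    intro e e₁ e₂ h₁ h₂
    obtain ⟨F, hF, he⟩ := G.exists_isBicomponent_mem e
    have mem_of_le (a : G.E) (ha : p a e) : a ∈ F := by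
      obtain ⟨F', hF', ha'⟩ := G.exists_isBicomponent_mem a
      by_contra haF
      exact hincomp F' F hF' hF (fun h => haF (h ▸ ha')) a ha' e he ha
    exact ih F hF ⟨e, he⟩ ⟨e₁, mem_of_le _ h₁⟩ ⟨e₂, mem_of_le _ h₂⟩ h₁ h₂

end Multigraph

/-- In a preorder on a finite type, given as a relation, every element lies above a minimal one. -/
theorem exists_minimal_rel {α : Type*} [Finite α] {r : α → α → Prop}
    (hrefl : ∀ a, r a a) (htrans : ∀ {a b c}, r a b → r b c → r a c) (a : α) :
    ∃ b, r b a ∧ ∀ c, r c b → r b c := by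
  let _ : Preorder α := { le := r, le_refl := hrefl, le_trans := fun _ _ _ h₁ h₂ => htrans h₁ h₂ }
  obtain ⟨b, hba, hb⟩ := (Set.toFinite (Set.univ : Set α)).exists_le_minimal (Set.mem_univ a)
  exact ⟨b, hba, fun c hc => hb.le_of_le (Set.mem_univ c) hc⟩

/-- Corollary 3.5: for every edge `e` of an enriched graph, the set of
classes below `[e]ₚ` is totally ordered; consequently the components of the Hasse diagram
of `E(Γ)ₚ` are rooted trees whose roots are the classes of the `p`-minimal edges: below
every edge there is a minimal edge. -/
theorem hasse_rooted_trees (Γ : Multigraph) (p : Γ.E → Γ.E → Prop)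
    (h : Multigraph.IsEnriched Γ p) :
    (∀ e e₁ e₂ : Γ.E, p e₁ e → p e₂ e → p e₁ e₂ ∨ p e₂ e₁) ∧
    (∀ e : Γ.E, ∃ e₀ : Γ.E, p e₀ e ∧ ∀ e' : Γ.E, p e' e₀ → p e₀ e') := by
  exact ⟨h.total_of_le, exists_minimal_rel h.refl h.trans⟩
end

section
/- Every enriched structure is a specialization of a generic one: for every enriched graph (Γ, p) there exists a generic enriched structure p' on Γ (i.e. p' is a partial order) such that (Γ, p') specializes to (Γ, p). -/
/-! ### Separators of a set family -/

/-- `U` is a separator of the set family `𝓒`: intersecting with `U` preserves `𝓒`. -/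
def IsSeparator {α : Type*} (𝓒 : Set (Set α)) (U : Set α) : Prop :=
  ∀ C ∈ 𝓒, C ∩ U ∈ 𝓒

/-- `b` lies in every separator of `𝓒` containing `a`. -/
def Linked {α : Type*} (𝓒 : Set (Set α)) (a b : α) : Prop :=
  ∀ U, IsSeparator 𝓒 U → a ∈ U → b ∈ U

theorem IsSeparator.inter {α : Type*} {𝓒 : Set (Set α)} {U U' : Set α}
    (h : IsSeparator 𝓒 U) (h' : IsSeparator 𝓒 U') : IsSeparator 𝓒 (U ∩ U') := by
  intro C hC
  rw [← Set.inter_assoc]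
  exact h' _ (h _ hC)

theorem Linked.refl {α : Type*} (𝓒 : Set (Set α)) (a : α) : Linked 𝓒 a a :=
  fun _ _ h => h

theorem Linked.trans {α : Type*} {𝓒 : Set (Set α)} {a b c : α}
    (h : Linked 𝓒 a b) (h' : Linked 𝓒 b c) : Linked 𝓒 a c :=
  fun U hU ha => h' U hU (h U hU ha)

theorem exists_isSeparator_linked {α : Type*} [Finite α] (𝓒 : Set (Set α)) (a : α) :
    ∃ M, IsSeparator 𝓒 M ∧ a ∈ M ∧ ∀ b ∈ M, Linked 𝓒 a b := by
  obtain ⟨M, hM⟩ := (Set.toFinite {U | IsSeparator 𝓒 U ∧ a ∈ U}).exists_minimal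
    ⟨Set.univ, fun C hC => by simpa using hC, Set.mem_univ a⟩
  refine ⟨M, hM.prop.1, hM.prop.2, fun b hb U hU ha => ?_⟩
  exact (hM.le_of_le ⟨hM.prop.1.inter hU, hM.prop.2, ha⟩ Set.inter_subset_left hb).2

theorem isSeparator_image {α β : Type*} {𝓒 : Set (Set α)} {𝓓 : Set (Set β)} {ι : α → β}
    (hι : Function.Injective ι) (h : ∀ C, C ∈ 𝓒 ↔ ι '' C ∈ 𝓓)
    (hr : IsSeparator 𝓓 (Set.range ι)) {U : Set α} (hU : IsSeparator 𝓒 U) :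
    IsSeparator 𝓓 (ι '' U) := by
  intro D hD
  have h1 : ι ⁻¹' D ∈ 𝓒 := by
    rw [h, Set.image_preimage_eq_inter_range]
    exact hr D hD
  have h2 := (h _).1 (hU _ h1)
  rwa [Set.image_inter hι, Set.image_preimage_eq_inter_range, Set.inter_assoc,
    Set.inter_eq_right.2 (Set.image_subset_range ι U)] at h2

theorem linked_iff_of_injective {α β : Type*} {𝓒 : Set (Set α)} {𝓓 : Set (Set β)} {ι : α → β}
    (hι : Function.Injective ι) (h : ∀ C, C ∈ 𝓒 ↔ ι '' C ∈ 𝓓)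
    (hr : IsSeparator 𝓓 (Set.range ι)) (a b : α) :
    Linked 𝓒 a b ↔ Linked 𝓓 (ι a) (ι b) := by
  constructor
  · intro hl U hU ha
    refine hl (ι ⁻¹' U) (fun C hC => ?_) ha
    rw [h, Set.image_inter_preimage]
    exact hU _ ((h C).1 hC)
  · intro hl U hU ha
    have := hl _ (isSeparator_image hι h hr hU) (Set.mem_image_of_mem ι ha)
    exact (hι.mem_set_image).1 this

namespace Multigraph

/-! ### Cuts -/

theorem mem_crossEdges {G : Multigraph} {W : Set G.V} {e : G.E} :
    e ∈ G.crossEdges W ↔ ¬ (G.fst e ∈ W ↔ G.snd e ∈ W) := by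
  simp only [crossEdges, Set.mem_ofPred_eq]
  tauto

/-- The cuts of `G` that avoid the edge set `L`. -/
def cutsAvoiding (G : Multigraph) (L : Set G.E) : Set (Set G.E) :=
  {C | (∃ W, C = G.crossEdges W) ∧ ∀ e ∈ C, e ∉ L}

theorem IsSeparator.cutsAvoiding_mono {G : Multigraph} {L L' U : Set G.E} (hL : L ⊆ L')
    (hU : IsSeparator (G.cutsAvoiding L) U) : IsSeparator (G.cutsAvoiding L') U :=
  fun C hC => ⟨(hU C ⟨hC.1, fun e he h => hC.2 e he (hL h)⟩).1, fun e he => hC.2 e he.1⟩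

theorem Linked.cutsAvoiding_anti {G : Multigraph} {L L' : Set G.E} (hL : L ⊆ L') {e f : G.E}
    (h : Linked (G.cutsAvoiding L') e f) : Linked (G.cutsAvoiding L) e f :=
  fun U hU => h U (IsSeparator.cutsAvoiding_mono hL hU)

theorem IsSeparator.compl {G : Multigraph} {L U : Set G.E}
    (hU : IsSeparator (G.cutsAvoiding L) U) : IsSeparator (G.cutsAvoiding L) Uᶜ := by
  intro C hC
  obtain ⟨⟨W', hW'⟩, -⟩ := hU C hC
  obtain ⟨⟨W, rfl⟩, hL⟩ := hC
  refine ⟨⟨{x | ¬ (x ∈ W ↔ x ∈ W')}, ?_⟩, fun e he => hL e he.1⟩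
  ext e
  have := Set.ext_iff.1 hW' e
  simp only [Set.mem_inter_iff, mem_crossEdges, Set.mem_compl_iff, Set.mem_ofPred_eq] at this ⊢
  tauto

theorem Linked.symm {G : Multigraph} {L : Set G.E} {e f : G.E}
    (h : Linked (G.cutsAvoiding L) e f) : Linked (G.cutsAvoiding L) f e := by
  intro U hU hf
  by_contra he
  exact h _ (IsSeparator.compl hU) he hf

theorem linked_contract_iff {G : Multigraph} {S L : Set G.E} (hSL : S ⊆ L)
    (a b : (G.contract S).E) :
    Linked ((G.contract S).cutsAvoiding (Subtype.val ⁻¹' L)) a b ↔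
      Linked (G.cutsAvoiding L) a.1 b.1 := by
  refine linked_iff_of_injective (ι := fun x : {e : G.E // e ∉ S} => x.1)
    Subtype.val_injective (fun C => ?_) ?_ a b
  · constructor
    · rintro ⟨⟨W, rfl⟩, hL⟩
      refine ⟨⟨{x | (Quot.mk _ x : (G.contract S).V) ∈ W}, ?_⟩, ?_⟩
      · ext e
        constructor
        · rintro ⟨e, he, rfl⟩
          exact he
        · intro he
          refine ⟨⟨e, fun heS => ?_⟩, he, rfl⟩
          have hq : (Quot.mk _ (G.fst e) : (G.contract S).V) = Quot.mk _ (G.snd e) :=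
            Quot.sound ⟨e, heS, rfl, rfl⟩
          rw [mem_crossEdges, Set.mem_ofPred_eq, Set.mem_ofPred_eq, hq] at he
          exact he Iff.rfl
      · rintro _ ⟨e, he, rfl⟩
        exact hL e he
    · rintro ⟨⟨W, hW⟩, hL⟩
      refine ⟨⟨{q | Quot.lift (fun x => x ∈ W) ?_ q}, ?_⟩,
        fun e he => hL e.1 ⟨e, he, rfl⟩⟩
      · rintro x y ⟨e, he, rfl, rfl⟩
        by_contra hne
        have hmem : e ∈ G.crossEdges W := mem_crossEdges.2 fun h => hne (propext h)
        rw [← hW] at hmem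
        exact hL e hmem (hSL he)
      · ext e
        have h1 : e ∈ C ↔ e.1 ∈ G.crossEdges W := by
          rw [← hW]
          exact (Subtype.val_injective.mem_set_image).symm
        rw [h1]
        exact Iff.rfl
  · intro D hD
    rwa [Set.inter_eq_left.2]
    exact fun e he => ⟨⟨e, fun heS => hD.2 e he (hSL heS)⟩, rfl⟩

/-- Cuts of an edge subgraph are the restrictions of cuts. -/
theorem exists_crossEdges_edgeSubgraph_iff {G : Multigraph} {F : Set G.E}
    {C : Set (G.edgeSubgraph F).E} :
    (∃ W, C = (G.edgeSubgraph F).crossEdges W) ↔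
      ∃ W, Subtype.val '' C = G.crossEdges W ∩ F := by
  constructor
  · rintro ⟨W, rfl⟩
    refine ⟨Subtype.val '' W, ?_⟩
    have key : ∀ x : (G.edgeSubgraph F).V, x.1 ∈ Subtype.val '' W ↔ x ∈ W :=
      fun x => Subtype.val_injective.mem_set_image
    ext e
    constructor
    · rintro ⟨e, he, rfl⟩
      refine ⟨?_, e.2⟩
      exact mem_crossEdges.2 fun h => mem_crossEdges.1 he
        ((key ((G.edgeSubgraph F).fst e)).symm.trans (h.trans (key ((G.edgeSubgraph F).snd e))))
    · rintro ⟨he, heF⟩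
      refine ⟨⟨e, heF⟩, ?_, rfl⟩
      exact mem_crossEdges.2 fun h => mem_crossEdges.1 he ((key _).trans (h.trans (key _).symm))
  · rintro ⟨W, hW⟩
    refine ⟨Subtype.val ⁻¹' W, ?_⟩
    ext e
    have h1 : e ∈ C ↔ e.1 ∈ G.crossEdges W ∩ F := by
      rw [← hW]
      exact (Subtype.val_injective.mem_set_image).symm
    rw [h1]
    exact ⟨fun h => h.1, fun h => ⟨h, e.2⟩⟩

theorem linked_edgeSubgraph_iff {G : Multigraph} {F : Set G.E}
    (hF : IsSeparator (G.cutsAvoiding ∅) F) (L : Set G.E) (a b : (G.edgeSubgraph F).E) :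
    Linked ((G.edgeSubgraph F).cutsAvoiding (Subtype.val ⁻¹' L)) a b ↔
      Linked (G.cutsAvoiding L) a.1 b.1 := by
  refine linked_iff_of_injective (ι := fun x : {e : G.E // e ∈ F} => x.1)
    Subtype.val_injective (fun C => ?_) ?_ a b
  · have hsub : Subtype.val '' C ⊆ F := by
      rintro _ ⟨x, -, rfl⟩
      exact x.2
    refine and_congr (exists_crossEdges_edgeSubgraph_iff.trans ⟨?_, ?_⟩) ?_
    · rintro ⟨W, hW⟩
      obtain ⟨⟨W', hW'⟩, -⟩ := hF (G.crossEdges W) ⟨⟨W, rfl⟩, fun _ _ h => h⟩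
      exact ⟨W', hW.trans hW'⟩
    · rintro ⟨W, hW⟩
      refine ⟨W, ?_⟩
      rw [← hW]
      exact (Set.inter_eq_left.2 hsub).symm
    · constructor
      · rintro h _ ⟨x, hx, rfl⟩
        exact h x hx
      · exact fun h x hx => h x.1 ⟨x, hx, rfl⟩
  · rw [show (Set.range fun x : {e : G.E // e ∈ F} => x.1) = F from Subtype.range_val]
    exact IsSeparator.cutsAvoiding_mono (Set.empty_subset L) hF

/-! ### Biconnectedness and separators -/

theorem Biconnected.mem_of_inc {G : Multigraph} (hG : G.Biconnected) {U : Set G.E}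
    (hU : IsSeparator (G.cutsAvoiding ∅) U) {v : G.V} {a b : G.E}
    (hva : G.Inc v a) (hvb : G.Inc v b) (ha : a ∈ U) : b ∈ U := by
  by_cases hab : a = b
  · exact hab ▸ ha
  have hv := hG.2 v
  have hla : ¬ G.IsLoop a := fun hl => hv (Or.inr ⟨a, b, hab, hl, hva, hvb⟩)
  have hlb : ¬ G.IsLoop b := fun hl => hv (Or.inr ⟨b, a, Ne.symm hab, hl, hvb, hva⟩)
  obtain ⟨⟨W, hW⟩, -⟩ := hU (G.crossEdges {v}) ⟨⟨_, rfl⟩, fun _ _ h => h⟩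
  have other : ∀ c, G.Inc v c → ¬ G.IsLoop c → c ∈ G.crossEdges {v} ∧ ∃ x, x ≠ v ∧
      (c ∈ G.crossEdges W ↔ ¬ (v ∈ W ↔ x ∈ W)) := by
    intro c hc hl
    rw [mem_crossEdges, mem_crossEdges]
    rcases hc with rfl | rfl
    · exact ⟨fun h => hl (h.1 rfl).symm, G.snd c, fun h => hl h.symm, Iff.rfl⟩
    · exact ⟨fun h => hl (h.2 rfl), G.fst c, hl, by tauto⟩
  obtain ⟨hca, x, hx, hax⟩ := other a hva hla
  obtain ⟨hcb, y, hy, hby⟩ := other b hvb hlb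
  have hconn : G.ConnectedOn {w | w ≠ v} := by
    by_contra h
    exact hv (Or.inl ⟨⟨x, hx⟩, h⟩)
  have hxy : ∀ z, Relation.ReflTransGen (G.AdjOn {w | w ≠ v}) x z → (x ∈ W ↔ z ∈ W) := by
    intro z hz
    induction hz with
    | refl => exact Iff.rfl
    | tail _ hstep ih =>
      rw [ih]
      obtain ⟨h1, h2, c, hc⟩ := hstep
      have hnc : c ∉ G.crossEdges W := by
        rw [← hW]
        rintro ⟨hc', -⟩
        rw [mem_crossEdges] at hc'
        simp only [Set.mem_singleton_iff, Set.mem_ofPred_eq] at hc' h1 h2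
        rcases hc with ⟨rfl, rfl⟩ | ⟨rfl, rfl⟩ <;> tauto
      rw [mem_crossEdges, not_not] at hnc
      rcases hc with ⟨rfl, rfl⟩ | ⟨rfl, rfl⟩
      · exact hnc
      · exact hnc.symm
  have haW : a ∈ G.crossEdges W := hW ▸ ⟨hca, ha⟩
  have hbW : b ∈ G.crossEdges W := by
    rw [hby, ← hxy y (hconn.2 x hx y hy)]
    exact hax.1 haW
  rw [← hW] at hbW
  exact hbW.2

theorem Biconnected.linked {G : Multigraph} (hG : G.Biconnected) (e f : G.E) :
    Linked (G.cutsAvoiding ∅) e f := by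
  intro U hU he
  have key : ∀ v, Relation.ReflTransGen (G.AdjOn Set.univ) (G.fst e) v →
      ∀ a, G.Inc v a → a ∈ U := by
    intro v hv
    induction hv with
    | refl => exact fun a ha => hG.mem_of_inc hU (Or.inl rfl) ha he
    | tail _ hstep ih =>
      obtain ⟨-, -, c, hc⟩ := hstep
      intro a ha
      rcases hc with ⟨h1, h2⟩ | ⟨h1, h2⟩
      · exact hG.mem_of_inc hU (Or.inr h2) ha (ih c (Or.inl h1))
      · exact hG.mem_of_inc hU (Or.inl h1) ha (ih c (Or.inr h2))
  exact key _ (hG.1.2 (G.fst e) trivial (G.fst f) trivial) f (Or.inl rfl)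

theorem connectedOn_of_linked {G : Multigraph} (hV : ∀ v : G.V, ∃ e, G.Inc v e)
    (hl : ∀ e f : G.E, Linked (G.cutsAvoiding ∅) e f) {T : Set G.V} (hT : T.Nonempty)
    (hTc : Tᶜ.Subsingleton) : G.ConnectedOn T := by
  refine ⟨hT, fun a ha b hb => ?_⟩
  set R : Set G.V := {x | Relation.ReflTransGen (G.AdjOn T) a x} with hR
  have hRT : R ⊆ T := by
    intro x hx
    rcases Relation.ReflTransGen.cases_tail hx with rfl | ⟨_, -, h⟩
    · exact ha
    · exact h.2.1
  have hadj : ∀ e : G.E, ∀ x y, (G.fst e = x ∧ G.snd e = y) ∨ (G.fst e = y ∧ G.snd e = x) →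
      x ∈ R → y ∈ T → y ∈ R :=
    fun e x y he hx hy => Relation.ReflTransGen.tail hx ⟨hRT hx, hy, e, he⟩
  have hsep : IsSeparator (G.cutsAvoiding ∅) {e | G.fst e ∈ R ∨ G.snd e ∈ R} := by
    rintro _ ⟨⟨X, rfl⟩, -⟩
    set X' : Set G.V := {x | (x ∈ R ∧ x ∈ X) ∨ (x ∉ R ∧ ∃ v ∈ Tᶜ, v ∈ X)}
    have hin : ∀ x ∈ R, (x ∈ X' ↔ x ∈ X) := fun x hx => by simp [X', hx]
    have hout : ∀ x ∉ R, (x ∈ X' ↔ ∃ v ∈ Tᶜ, v ∈ X) := fun x hx => by simp [X', hx]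
    have hbase : ∀ x ∉ T, (x ∈ X' ↔ x ∈ X) := fun x hx =>
      (hout x fun h => hx (hRT h)).trans
        ⟨fun ⟨w, hw, hwX⟩ => hTc hw hx ▸ hwX, fun h => ⟨x, hx, h⟩⟩
    refine ⟨⟨X', ?_⟩, fun _ _ h => h⟩
    ext e
    rw [Set.mem_inter_iff, mem_crossEdges, mem_crossEdges]
    by_cases heR : G.fst e ∈ R ∨ G.snd e ∈ R
    · have hagree : ∀ x, x ∈ R ∨ x ∉ T → (x ∈ X' ↔ x ∈ X) :=
        fun x hx => hx.elim (hin x) (hbase x)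
      have h1 : G.fst e ∈ R ∨ G.fst e ∉ T := by
        by_contra! h
        exact h.1 (hadj e _ _ (Or.inr ⟨rfl, rfl⟩) (heR.resolve_left h.1) h.2)
      have h2 : G.snd e ∈ R ∨ G.snd e ∉ T := by
        by_contra! h
        exact h.1 (hadj e _ _ (Or.inl ⟨rfl, rfl⟩) (heR.resolve_right h.1) h.2)
      rw [hagree _ h1, hagree _ h2]
      exact and_iff_left heR
    · have hne := not_or.1 heR
      rw [hout _ hne.1, hout _ hne.2]
      exact iff_of_false (fun h => heR h.2) (fun h => h Iff.rfl)
  obtain ⟨e, he⟩ := hV a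
  obtain ⟨f, hf⟩ := hV b
  have haR : a ∈ R := Relation.ReflTransGen.refl
  have hfR := hl e f _ hsep (by rcases he with rfl | rfl <;> simp [haR])
  change b ∈ R
  rcases hf with rfl | rfl
  · exact hfR.elim id fun h => hadj f _ _ (Or.inr ⟨rfl, rfl⟩) h hb
  · exact hfR.elim (fun h => hadj f _ _ (Or.inl ⟨rfl, rfl⟩) h hb) id

theorem biconnected_of_linked {G : Multigraph} [Nonempty G.E] (hV : ∀ v : G.V, ∃ e, G.Inc v e)
    (hl : ∀ e f : G.E, Linked (G.cutsAvoiding ∅) e f) : G.Biconnected := by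
  obtain ⟨e₀⟩ := ‹Nonempty G.E›
  refine ⟨connectedOn_of_linked hV hl ⟨G.fst e₀, trivial⟩ (by simp), fun v hv => ?_⟩
  rcases hv with ⟨hne, hcon⟩ | ⟨e, f, hef, hloop, -, -⟩
  · refine hcon (connectedOn_of_linked hV hl hne fun x hx y hy => ?_)
    simp only [Set.mem_compl_iff, Set.mem_ofPred_eq, not_not] at hx hy
    exact hx.trans hy.symm
  · refine hef (hl e f {e} ?_ rfl).symm
    rintro _ ⟨⟨X, rfl⟩, -⟩
    refine ⟨⟨∅, ?_⟩, fun _ _ h => h⟩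
    ext c
    simp only [Set.mem_inter_iff, mem_crossEdges, Set.mem_singleton_iff, Set.mem_empty_iff_false,
      iff_self, not_true_eq_false, iff_false, not_and]
    rintro h rfl
    exact h (by rw [show G.fst c = G.snd c from hloop])

theorem edgeSubgraph_biconnected_of_linked {G : Multigraph} {M : Set G.E} {e : G.E}
    (hM : IsSeparator (G.cutsAvoiding ∅) M) (heM : e ∈ M)
    (hl : ∀ f ∈ M, Linked (G.cutsAvoiding ∅) e f) : (G.edgeSubgraph M).Biconnected := by
  have : Nonempty (G.edgeSubgraph M).E := ⟨⟨e, heM⟩⟩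
  refine biconnected_of_linked ?_ fun a b => ?_
  · rintro ⟨v, f, hf, hvf⟩
    exact ⟨⟨f, hf⟩, hvf.imp (fun h => Subtype.ext h) fun h => Subtype.ext h⟩
  · exact (linked_edgeSubgraph_iff hM ∅ a b).2 ((Linked.symm (hl a.1 a.2)).trans (hl b.1 b.2))

theorem subset_of_edgeSubgraph_biconnected {G : Multigraph} {F U : Set G.E} {e : G.E}
    (hF : (G.edgeSubgraph F).Biconnected) (heF : e ∈ F)
    (hU : IsSeparator (G.cutsAvoiding ∅) U) (heU : e ∈ U) : F ⊆ U := by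
  intro f hf
  refine hF.linked ⟨e, heF⟩ ⟨f, hf⟩ (Subtype.val ⁻¹' U) (fun C hC => ⟨?_, fun _ _ h => h⟩) heU
  obtain ⟨W, hW⟩ := exists_crossEdges_edgeSubgraph_iff.1 hC.1
  obtain ⟨⟨W', hW'⟩, -⟩ := hU (G.crossEdges W) ⟨⟨W, rfl⟩, fun _ _ h => h⟩
  refine exists_crossEdges_edgeSubgraph_iff.2 ⟨W', ?_⟩
  rw [← hW', Set.inter_right_comm, ← hW]
  exact Set.image_inter_preimage _ C U

theorem exists_isBicomponent_mem_s15 {G : Multigraph} (e : G.E) : ∃ F, G.IsBicomponent F ∧ e ∈ F := by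
  obtain ⟨M, hM, heM, hl⟩ := exists_isSeparator_linked (G.cutsAvoiding ∅) e
  refine ⟨M, ⟨edgeSubgraph_biconnected_of_linked hM heM hl, fun F' hF' hbic => ?_⟩, heM⟩
  exact (subset_of_edgeSubgraph_biconnected hbic (hF' heM) hM heM).antisymm hF'

theorem IsBicomponent.isSeparator {G : Multigraph} {F : Set G.E} (hF : G.IsBicomponent F) :
    IsSeparator (G.cutsAvoiding ∅) F := by
  obtain ⟨⟨_, e, heF, -⟩, -⟩ := hF.1.1.1
  obtain ⟨M, hM, heM, hl⟩ := exists_isSeparator_linked (G.cutsAvoiding ∅) e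
  rw [← hF.2 M (subset_of_edgeSubgraph_biconnected hF.1 heF hM heM)
    (edgeSubgraph_biconnected_of_linked hM heM hl)]
  exact hM

theorem IsBicomponent.eq_of_mem {G : Multigraph} {F F' : Set G.E} (hF : G.IsBicomponent F)
    (hF' : G.IsBicomponent F') {e : G.E} (he : e ∈ F) (he' : e ∈ F') : F = F' :=
  (subset_of_edgeSubgraph_biconnected hF.1 he hF'.isSeparator he').antisymm
    (subset_of_edgeSubgraph_biconnected hF'.1 he' hF.isSeparator he)

theorem Connected.contract {G : Multigraph} (hG : G.Connected) (S : Set G.E) :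
    (G.contract S).Connected := by
  refine ⟨hG.1.image (Quot.mk _) |>.mono (Set.subset_univ _), ?_⟩
  rintro ⟨a⟩ - ⟨b⟩ -
  induction hG.2 a trivial b trivial with
  | refl => exact Relation.ReflTransGen.refl
  | @tail x y _ hstep ih =>
    obtain ⟨-, -, c, hc⟩ := hstep
    by_cases hcS : c ∈ S
    · have hq : (Quot.mk _ x : (G.contract S).V) = Quot.mk _ y := by
        rcases hc with ⟨rfl, rfl⟩ | ⟨rfl, rfl⟩
        · exact Quot.sound ⟨c, hcS, rfl, rfl⟩
        · exact (Quot.sound ⟨c, hcS, rfl, rfl⟩).symm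
      exact hq ▸ ih
    · refine ih.tail ⟨trivial, trivial, ⟨c, hcS⟩, ?_⟩
      rcases hc with ⟨rfl, rfl⟩ | ⟨rfl, rfl⟩
      · exact Or.inl ⟨rfl, rfl⟩
      · exact Or.inr ⟨rfl, rfl⟩

/-! ### The generic enriched structure attached to a ranking of the edges -/

/-- The order in which `e` lies below `f` when `e` precedes `f` in the ranking `r` and both edges
lie in the same block after contracting all edges that precede `e`. -/
def rankOrder (G : Multigraph) (r : G.E → ℕ) (e f : G.E) : Prop :=
  r e ≤ r f ∧ Linked (G.cutsAvoiding {g | r g < r e}) e f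

theorem rankOrder_refl (G : Multigraph) (r : G.E → ℕ) (e : G.E) : G.rankOrder r e e :=
  ⟨le_rfl, Linked.refl _ e⟩

theorem rankOrder_trans (G : Multigraph) (r : G.E → ℕ) ⦃e f g : G.E⦄ :
    G.rankOrder r e f → G.rankOrder r f g → G.rankOrder r e g := by
  rintro ⟨h1, h2⟩ ⟨h3, h4⟩
  exact ⟨h1.trans h3, h2.trans (Linked.cutsAvoiding_anti
    (fun x (hx : r x < r e) => hx.trans_le h1) h4)⟩

theorem rankOrder_antisymm {G : Multigraph} {r : G.E → ℕ} (hr : Function.Injective r) {e f : G.E}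
    (h : G.rankOrder r e f) (h' : G.rankOrder r f e) : e = f :=
  hr (h.1.antisymm h'.1)

theorem isEnriched_rankOrder_of_biconnected {G : Multigraph} {r : G.E → ℕ}
    (hr : Function.Injective r) (hG : G.Biconnected)
    (hrec : ∀ e : G.E, IsEnriched (G.contract {e}) ((G.contract {e}).rankOrder fun x => r x.1)) :
    IsEnriched G (G.rankOrder r) := by
  rcases isEmpty_or_nonempty G.E with hE | hE
  · exact .of_subsingleton _ _ (rankOrder_refl _ _) (rankOrder_trans _ _) inferInstance
  obtain ⟨e, he⟩ := Finite.exists_min r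
  have hempty : {g | r g < r e} = ∅ :=
    Set.eq_empty_of_forall_notMem fun g hg => (he g).not_gt hg
  refine .of_biconnected _ _ (rankOrder_refl _ _) (rankOrder_trans _ _) hG {e}
    (Set.singleton_nonempty e) ?_ ?_ ?_
  · rintro a _ h rfl
    exact hr (h.1.antisymm (he a))
  · rintro _ rfl f
    refine ⟨he f, ?_⟩
    rw [hempty]
    exact hG.linked _ f
  · convert hrec e using 1
    funext a b
    refine propext (and_congr Iff.rfl (linked_contract_iff ?_ a b).symm)
    rintro _ rfl
    exact lt_of_le_of_ne (he a.1) fun h => a.2 (hr h.symm)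

theorem isEnriched_rankOrder_of_separatingVertex {G : Multigraph} {r : G.E → ℕ}
    (hG : ∃ v, G.SeparatingVertex v)
    (hrec : ∀ F, G.IsBicomponent F →
      IsEnriched (G.edgeSubgraph F) ((G.edgeSubgraph F).rankOrder fun x => r x.1)) :
    IsEnriched G (G.rankOrder r) := by
  refine .of_separating _ _ (rankOrder_refl _ _) (rankOrder_trans _ _) hG
    (fun F hF => ?_) ?_
  · convert hrec F hF using 1
    funext a b
    exact propext (and_congr Iff.rfl (linked_edgeSubgraph_iff hF.isSeparator _ a b).symm)
  · rintro F F' hF hF' hne e he e' he' h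
    exact hne (hF.eq_of_mem hF'
      (Linked.cutsAvoiding_anti (Set.empty_subset _) h.2 F hF.isSeparator he) he')

theorem Connected.isEnriched_rankOrder {G : Multigraph} (hG : G.Connected) {r : G.E → ℕ}
    (hr : Function.Injective r) : IsEnriched G (G.rankOrder r) := by
  induction hn : Nat.card G.E using Nat.strong_induction_on generalizing G with
  | _ n ih =>
    have hbic : ∀ (H : Multigraph) (s : H.E → ℕ), Function.Injective s → H.Biconnected →
        Nat.card H.E ≤ n → IsEnriched H (H.rankOrder s) := by
      intro H s hs hH hcard
      refine isEnriched_rankOrder_of_biconnected hs hH fun e => ?_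
      refine ih (Nat.card (H.contract {e}).E) ?_ (hH.1.contract {e})
        (hs.comp Subtype.val_injective) rfl
      exact (Finite.card_subtype_lt (p := fun x => x ∉ ({e} : Set H.E)) (x := e)
        (by simp)).trans_le hcard
    by_cases hsep : ∃ v, G.SeparatingVertex v
    · refine isEnriched_rankOrder_of_separatingVertex hsep fun F hF => ?_
      exact hbic _ _ (hr.comp Subtype.val_injective) hF.1 (hn ▸ Finite.card_subtype_le _)
    · exact hbic G r hr ⟨hG, not_exists.1 hsep⟩ hn.le

theorem IsEnriched.isEnriched_rankOrder {G : Multigraph} {p : G.E → G.E → Prop}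
    (h : IsEnriched G p) {r : G.E → ℕ} (hr : Function.Injective r) :
    IsEnriched G (G.rankOrder r) := by
  cases h with
  | of_subsingleton _ _ _ _ hsub =>
    exact .of_subsingleton _ _ (rankOrder_refl _ _) (rankOrder_trans _ _) hsub
  | of_biconnected _ _ _ _ hbic => exact hbic.1.isEnriched_rankOrder hr
  | of_separating _ _ _ _ hsep =>
    exact isEnriched_rankOrder_of_separatingVertex hsep fun F hF =>
      hF.1.1.isEnriched_rankOrder (hr.comp Subtype.val_injective)

/-! ### Comparison with a given enriched structure -/

theorem IsEnriched.trans_s15 {G : Multigraph} {p : G.E → G.E → Prop} (h : IsEnriched G p)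
    ⦃a b c : G.E⦄ : p a b → p b c → p a c := by
  cases h with
  | of_subsingleton _ _ _ htrans => exact @htrans a b c
  | of_biconnected _ _ _ htrans => exact @htrans a b c
  | of_separating _ _ _ htrans => exact @htrans a b c

theorem IsEnriched.exists_lower_bound {G : Multigraph} {p : G.E → G.E → Prop}
    (h : IsEnriched G p) {L : Set G.E} (hL : ∀ a b, p a b → b ∈ L → a ∈ L) {e f : G.E}
    (he : e ∉ L) (hf : f ∉ L) (hef : Linked (G.cutsAvoiding L) e f) :
    ∃ m, m ∉ L ∧ p m e ∧ p m f := by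
  induction h with
  | of_subsingleton G p hrefl htrans hsub =>
    obtain rfl := Subsingleton.elim e f
    exact ⟨e, he, hrefl e, hrefl e⟩
  | of_biconnected G p hrefl htrans hbic S hne hlow hmin hrec ih =>
    rcases L.eq_empty_or_nonempty with rfl | ⟨l, hl⟩
    · obtain ⟨m, hm⟩ := hne
      exact ⟨m, id, hmin m hm e, hmin m hm f⟩
    · have hSL : S ⊆ L := fun s hs => hL s l (hmin s hs l) hl
      obtain ⟨m, hm, h1, h2⟩ := ih (L := Subtype.val ⁻¹' L) (e := ⟨e, fun h => he (hSL h)⟩)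
        (f := ⟨f, fun h => hf (hSL h)⟩) (fun a b => hL a.1 b.1) he hf
        ((linked_contract_iff hSL _ _).2 hef)
      exact ⟨m.1, hm, h1, h2⟩
  | of_separating G p hrefl htrans hsep hcomp hincomp ih =>
    obtain ⟨F, hF, heF⟩ := exists_isBicomponent_mem_s15 e
    have hfF := Linked.cutsAvoiding_anti (Set.empty_subset L) hef F hF.isSeparator heF
    obtain ⟨m, hm, h1, h2⟩ := ih F hF (L := Subtype.val ⁻¹' L) (e := ⟨e, heF⟩) (f := ⟨f, hfF⟩)
      (fun a b => hL a.1 b.1) he hf ((linked_edgeSubgraph_iff hF.isSeparator L _ _).2 hef)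
    exact ⟨m.1, hm, h1, h2⟩

theorem IsEnriched.le_of_rankOrder {G : Multigraph} {p : G.E → G.E → Prop}
    (h : IsEnriched G p) {r : G.E → ℕ} (hrp : ∀ a b, StrictBelow G p a b → r a < r b)
    {e f : G.E} (hef : G.rankOrder r e f) : p e f := by
  have htrans := h.trans_s15
  obtain ⟨m, hm, hme, hmf⟩ := h.exists_lower_bound (L := {g | StrictBelow G p g e})
    (fun a b hab hb => ⟨htrans hab hb.1, fun hea => hb.2 (htrans hea hab)⟩)
    (fun he => he.2 he.1) (fun hf => (hrp f e hf).not_ge hef.1)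
    (Linked.cutsAvoiding_anti (fun g hg => hrp g e hg) hef.2)
  by_cases hem : p e m
  · exact htrans hem hmf
  · exact absurd ⟨hme, hem⟩ hm

theorem exists_injective_rank {G : Multigraph} {p : G.E → G.E → Prop}
    (htrans : ∀ ⦃a b c⦄, p a b → p b c → p a c) :
    ∃ r : G.E → ℕ, Function.Injective r ∧ ∀ a b, StrictBelow G p a b → r a < r b := by
  obtain ⟨n, ⟨φ⟩⟩ := Finite.exists_equiv_fin G.E
  let k : G.E → ℕ := fun e => {g | StrictBelow G p g e}.ncard
  have hk : ∀ a b, StrictBelow G p a b → k a < k b := fun a b hab =>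
    Set.ncard_lt_ncard ⟨fun g hg => ⟨htrans hg.1 hab.1, fun h => hab.2 (htrans h hg.1)⟩,
      fun hsub => (hsub hab).2 (hsub hab).1⟩
  refine ⟨fun e => n * k e + φ e, fun a b hab => ?_, fun a b hab => ?_⟩
  · have := congrArg (· % n) hab
    simp only [Nat.mul_add_mod, Nat.mod_eq_of_lt (φ _).2] at this
    exact φ.injective (Fin.ext this)
  · have h1 := Nat.mul_le_mul_left n (hk a b hab)
    have h2 := (φ a).2
    rw [Nat.mul_succ] at h1
    show n * k a + φ a < n * k b + φ b
    omega

end Multigraph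

/-- Corollary 3.19: every enriched structure is a specialization of a
generic one, i.e. of a partial order. -/
theorem exists_generic_specializing (Γ : Multigraph) (p : Γ.E → Γ.E → Prop)
    (h : Multigraph.IsEnriched Γ p) :
    ∃ p' : Γ.E → Γ.E → Prop,
      Multigraph.IsEnriched Γ p' ∧
      (∀ e e' : Γ.E, p' e e' → p' e' e → e = e') ∧
      Multigraph.SpecializesSame Γ p' p := by
  obtain ⟨r, hr, hrp⟩ := Multigraph.exists_injective_rank h.trans_s15
  have hp' := h.isEnriched_rankOrder hr
  exact ⟨Γ.rankOrder r, hp', fun _ _ => Multigraph.rankOrder_antisymm hr,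
    hp', h, fun _ _ => h.le_of_rankOrder hrp⟩
end
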